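/- For every dimension d ∈ ℕ, d ≥ 1, there exists a constant M₀ > 0 such that for every f ∈ L¹(ℝ^d), every multi-index β ∈ ℕ^d and integers k, m ∈ ℕ with |β| + k > 0 and 0 ≤ m ≤ k, for every 1 ≤ q ≤ ∞ and every t > 0, ‖D_x^β ∂_t^k (t^m ∇G(·,t) ∗ f)‖_{L^q(ℝ^d)} ≤ M₀^{|β|/2 + k} (|β|+k)^{(|β|+1)/2 + k + (d/2)(1−1/q)} t^{−(|β|+2(k−m)+1)/2 − (d/2)(1−1/q)} ‖f‖_{L¹(ℝ^d)}. -/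

import Mathlib

open MeasureTheory Real Filter
open scoped ENNReal BigOperators Topology

noncomputable section

abbrev Euc (d : ℕ) : Type := EuclideanSpace ℝ (Fin d)

/-- The heat kernel on `ℝ^d`. -/
noncomputable def heatKernel (d : ℕ) (t : ℝ) (x : Euc d) : ℝ :=
  (4 * Real.pi * t) ^ (-(d : ℝ) / 2) * Real.exp (-‖x‖ ^ 2 / (4 * t))

/-- Partial derivative in the `i`-th coordinate direction. -/
noncomputable def pd {d : ℕ} {F : Type*} [NormedAddCommGroup F] [NormedSpace ℝ F]
    (i : Fin d) (f : Euc d → F) : Euc d → F :=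
  fun x => fderiv ℝ f x (EuclideanSpace.single i 1)

/-- Multi-index spatial derivative `D_x^β`. -/
noncomputable def mderiv {d : ℕ} {F : Type*} [NormedAddCommGroup F] [NormedSpace ℝ F]
    (β : Fin d → ℕ) (f : Euc d → F) : Euc d → F :=
  (List.finRange d).foldr (fun i g => (pd i)^[β i] g) f

/-- `k`-th time derivative (pointwise in space). -/
noncomputable def tderiv {d : ℕ} {F : Type*} [NormedAddCommGroup F] [NormedSpace ℝ F]
    (k : ℕ) (ρ : ℝ → Euc d → F) (t : ℝ) : Euc d → F :=
  fun x => iteratedDeriv k (fun s => ρ s x) t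

/-- Convolution of two scalar functions on `ℝ^d`. -/
noncomputable def conv {d : ℕ} (f g : Euc d → ℝ) : Euc d → ℝ :=
  fun x => ∫ y, f (x - y) * g y

/-- Convolution of a vector field with a scalar function on `ℝ^d`. -/
noncomputable def convV {d : ℕ} (f : Euc d → Euc d) (g : Euc d → ℝ) : Euc d → Euc d :=
  fun x => ∫ y, g y • f (x - y)

/-- Gradient of the heat kernel. -/
noncomputable def gradHeat (d : ℕ) (t : ℝ) : Euc d → Euc d :=
  gradient (fun x => heatKernel d t x)

/-- Gradient of the logarithmic potential `c` generated by `ρ`. -/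
noncomputable def gradc (d : ℕ) (ρ : Euc d → ℝ) (x : Euc d) : Euc d :=
  (-(1 / (d * Real.pi))) • ∫ y, (ρ y / ‖x - y‖ ^ 2) • (x - y)

/-- `|β|` for a multi-index. -/
def msize {d : ℕ} (β : Fin d → ℕ) : ℕ := ∑ i, β i

/-- The exponent `2d/(2d-1)` as an element of `ℝ≥0∞`. -/
noncomputable def qd (d : ℕ) : ℝ≥0∞ := (2 * d : ℝ≥0∞) / (2 * d - 1 : ℝ≥0∞)

/-- Right-hand side of the Duhamel formula for the mPKS equations. -/
noncomputable def mildRHS (d : ℕ) (ρ₀ : Euc d → ℝ) (ρ : ℝ → Euc d → ℝ) (t : ℝ) (x : Euc d) : ℝ :=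
  conv (heatKernel d t) ρ₀ x -
    ∫ s in Set.Ioc (0:ℝ) t,
      ∫ y, (inner ℝ (gradHeat d (t - s) (x - y)) (ρ s y • gradc d (ρ s) y) : ℝ)

/-- Mild solution of the mPKS equations on `[0,T]`. -/
def IsMildSolution (d : ℕ) (ρ₀ : Euc d → ℝ) (T : ℝ) (ρ : ℝ → Euc d → ℝ) : Prop :=
  ∀ t ∈ Set.Ioc (0:ℝ) T, ∀ x, ρ t x = mildRHS d ρ₀ ρ t x

/-- Membership in the space `X_T`. -/
def MemXT (d : ℕ) (T : ℝ) (ρ : ℝ → Euc d → ℝ) : Prop :=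
  (∀ t ∈ Set.Ioc (0:ℝ) T, MemLp (ρ t) 1 volume) ∧
  (∀ t ∈ Set.Ioc (0:ℝ) T,
    Filter.Tendsto (fun s => eLpNorm (fun x => ρ s x - ρ t x) 1 volume)
      (nhdsWithin t (Set.Ioc (0:ℝ) T)) (nhds 0)) ∧
  (∃ C : ℝ≥0∞, C ≠ ⊤ ∧ ∀ t ∈ Set.Ioc (0:ℝ) T, eLpNorm (ρ t) 1 volume ≤ C) ∧
  (∃ C : ℝ≥0∞, C ≠ ⊤ ∧ ∀ t ∈ Set.Ioc (0:ℝ) T,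
    ENNReal.ofReal (t ^ (1/4 : ℝ)) * eLpNorm (ρ t) (qd d) volume ≤ C)

/-- Assumption (𝒜): decay of the heat semigroup applied to `ρ₀`. -/
def AssumptionA (d : ℕ) (ρ₀ : Euc d → ℝ) (T θ : ℝ) : Prop :=
  ∀ q : ℝ≥0∞, 1 ≤ q → ∀ t ∈ Set.Ioc (0:ℝ) T,
    ENNReal.ofReal (t ^ (((d : ℝ) / 2) * (1 - q⁻¹.toReal))) *
      eLpNorm (conv (heatKernel d t) ρ₀) q volume ≤ ENNReal.ofReal θ


def gk : ℕ → ℝ → ℝ → ℝ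
  | 0, s, x => (4 * π * s) ^ (-(1:ℝ) / 2) * Real.exp (-x ^ 2 / (4 * s))
  | 1, s, x => -(x * ((4 * π * s) ^ (-(1:ℝ) / 2) * Real.exp (-x ^ 2 / (4 * s)))) / (2 * s)
  | (n+2), s, x => -(x * gk (n+1) s x + (n+1) * gk n s x) / (2 * s)

lemma gk_zero (s x : ℝ) : gk 0 s x = (4 * π * s) ^ (-(1:ℝ) / 2) * Real.exp (-x ^ 2 / (4 * s)) := by
  rw [gk]

lemma gk_one (s x : ℝ) : gk 1 s x = -(x * gk 0 s x) / (2 * s) := by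
  rw [gk, gk]

lemma gk_add_two (n : ℕ) (s x : ℝ) :
    gk (n+2) s x = -(x * gk (n+1) s x + (n+1) * gk n s x) / (2 * s) := by
  rw [gk]

lemma gk_hasDerivAt_x {s : ℝ} (hs : 0 < s) (n : ℕ) (x : ℝ) :
    HasDerivAt (fun x => gk n s x) (gk (n+1) s x) x := by
  induction n using Nat.twoStepInduction generalizing x with
  | zero =>
    have h : HasDerivAt (fun x : ℝ => -x ^ 2 / (4 * s)) (-(2 * x) / (4 * s)) x := by
      have := ((hasDerivAt_pow 2 x).neg).div_const (4 * s)
      simpa using this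
    have h2 := (h.exp).const_mul ((4 * π * s) ^ (-(1:ℝ) / 2))
    simp only [zero_add, gk_one, gk_zero]
    refine HasDerivAt.congr_deriv h2 ?_
    field_simp
    ring
  | one =>
    have h : HasDerivAt (fun x => gk 0 s x) (gk 1 s x) x := by
      have h : HasDerivAt (fun x : ℝ => -x ^ 2 / (4 * s)) (-(2 * x) / (4 * s)) x := by
        have := ((hasDerivAt_pow 2 x).neg).div_const (4 * s)
        simpa using this
      have h2 := (h.exp).const_mul ((4 * π * s) ^ (-(1:ℝ) / 2))
      simp only [gk_one, gk_zero]
      refine HasDerivAt.congr_deriv h2 ?_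
      field_simp
      ring
    have h2 := (((hasDerivAt_id x).mul h).neg).div_const (2 * s)
    have : (fun x => gk 1 s x) = fun x => -(x * gk 0 s x) / (2 * s) := by
      funext x; exact gk_one s x
    rw [this]
    refine HasDerivAt.congr_deriv h2 ?_
    rw [gk_add_two]
    simp
    ring
  | more n h0 h1 =>
    have h2 := ((((hasDerivAt_id x).mul (h1 x)).add ((h0 x).const_mul ((n:ℝ)+1))).neg).div_const (2 * s)
    have : (fun x => gk (n+2) s x) = fun x => -(x * gk (n+1) s x + (n+1) * gk n s x) / (2 * s) := by
      funext x; exact gk_add_two n s x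
    rw [this]
    refine HasDerivAt.congr_deriv h2 ?_
    rw [show n + 2 + 1 = (n+1) + 2 by ring, gk_add_two (n+1)]
    simp
    ring

lemma gk_hasDerivAt_s_zero {s : ℝ} (hs : 0 < s) (x : ℝ) :
    HasDerivAt (fun s => gk 0 s x) (gk 2 s x) s := by
  have h : HasDerivAt (fun s : ℝ => -x ^ 2 / (4 * s)) (x ^ 2 / (4 * s ^ 2)) s := by
    have := (((hasDerivAt_id s).const_mul 4).inv (by simpa using hs.ne')).const_mul (-x^2)
    refine HasDerivAt.congr_deriv this ?_
    simp only [id]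
    field_simp
  have h3 : HasDerivAt (fun s : ℝ => (4 * π * s) ^ (-(1:ℝ) / 2))
      (-1 / (2 * s) * (4 * π * s) ^ (-(1:ℝ) / 2)) s := by
    have hp : 0 < 4 * π * s := by positivity
    have := ((hasDerivAt_id s).const_mul (4 * π)).rpow_const (p := -(1:ℝ)/2) (Or.inl hp.ne')
    refine HasDerivAt.congr_deriv this ?_
    simp only [id]
    rw [Real.rpow_sub hp, Real.rpow_one]
    field_simp
  have h2 := h3.mul h.exp
  simp only [gk_add_two, gk_zero, gk_one, zero_add]
  refine HasDerivAt.congr_deriv h2 ?_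
  field_simp
  push_cast
  ring

lemma gk_hasDerivAt_s {s : ℝ} (hs : 0 < s) (n : ℕ) (x : ℝ) :
    HasDerivAt (fun s => gk n s x) (gk (n+2) s x) s := by
  have key : ∀ (φ : ℝ → ℝ) (φ' : ℝ), HasDerivAt φ φ' s →
      HasDerivAt (fun s => -(φ s) / (2 * s)) (-φ' / (2*s) + φ s / (2 * s^2)) s := by
    intro φ φ' h
    have := h.neg.div ((hasDerivAt_id s).const_mul 2) (by simpa using hs.ne')
    refine HasDerivAt.congr_deriv this ?_
    simp
    field_simp
  induction n using Nat.twoStepInduction with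
  | zero => exact gk_hasDerivAt_s_zero hs x
  | one =>
    have h2 := key _ _ ((gk_hasDerivAt_s_zero hs x).const_mul x)
    have : (fun s => gk 1 s x) = fun s => -(x * gk 0 s x) / (2 * s) := by
      funext s; exact gk_one s x
    rw [this]
    refine HasDerivAt.congr_deriv h2 ?_
    simp only [gk_add_two, gk_one, Nat.reduceAdd, zero_add]
    field_simp
    push_cast
    ring
  | more n h0 h1 =>
    have h2 := key _ _ ((h1.const_mul x).add (h0.const_mul ((n:ℝ)+1)))
    have : (fun s => gk (n+2) s x) = fun s => -(x * gk (n+1) s x + (n+1) * gk n s x) / (2 * s) := by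
      funext s; exact gk_add_two n s x
    rw [this]
    refine HasDerivAt.congr_deriv h2 ?_
    rw [gk_add_two (n+2), gk_add_two n]
    simp only [Pi.add_apply]
    rw [show n + 1 + 2 = n + 2 + 1 by ring]
    generalize gk (n+2+1) s x = a
    field_simp
    push_cast
    ring

def sg (N : ℕ) (s : ℝ) : ℝ := Real.exp 1 * (√(2 * s * N) / (2 * s))

lemma gk_bound1 {s : ℝ} (hs : 0 < s) (N : ℕ) (x : ℝ) (n : ℕ) (hn : n ≤ N) :
    |gk n s x| ≤ ((|x| + √(2 * s * N)) / (2 * s)) ^ n * gk 0 s x := by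
  have hg : 0 ≤ gk 0 s x := by rw [gk_zero]; positivity
  have hr : 0 ≤ √(2 * s * N) := by positivity
  have hrr : √(2 * s * N) ^ 2 = 2 * s * N := Real.sq_sqrt (by positivity)
  set r := √(2 * s * N)
  have hx := abs_nonneg x
  induction n using Nat.twoStepInduction with
  | zero => simp [abs_of_nonneg hg]
  | one =>
    rw [gk_one, abs_div, abs_neg, abs_mul, abs_of_nonneg hg, abs_of_pos (by positivity : 0 < 2 * s),
      pow_one, div_mul_eq_mul_div]
    gcongr
    linarith
  | more n h0 h1 =>
    have h0 := h0 (by omega)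
    have h1 := h1 (by omega)
    set z := (|x| + r) / (2 * s) with hz
    have hz0 : 0 ≤ z := by positivity
    rw [gk_add_two, abs_div, abs_neg, abs_of_pos (by positivity : 0 < 2 * s), div_le_iff₀ (by positivity)]
    calc |x * gk (n+1) s x + (n+1) * gk n s x|
        ≤ |x| * |gk (n+1) s x| + (n+1) * |gk n s x| := by
          refine (abs_add_le _ _).trans ?_
          rw [abs_mul, abs_mul, abs_of_nonneg (by positivity : (0:ℝ) ≤ n + 1)]
      _ ≤ |x| * (z ^ (n+1) * gk 0 s x) + N * (z ^ n * gk 0 s x) := by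
          have : (n:ℝ) + 1 ≤ N := by exact_mod_cast (by omega : n + 1 ≤ N)
          gcongr
      _ = (|x| * z + N) * (z ^ n * gk 0 s x) := by ring
      _ ≤ (z ^ 2 * (2 * s)) * (z ^ n * gk 0 s x) := by
          gcongr
          have h3 : z * (2 * s) = |x| + r := by rw [hz]; field_simp
          have : z ^ 2 * (2 * s) = z * (|x| + r) := by rw [← h3]; ring
          rw [this]
          have : (N:ℝ) ≤ z * r := by
            have : (N:ℝ) * (2 * s) ≤ z * r * (2 * s) := by
              have : z * r * (2 * s) = (|x| + r) * r := by rw [← h3]; ring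
              rw [this]; nlinarith [mul_nonneg hx hr]
            exact le_of_mul_le_mul_right this (by positivity)
          linarith
      _ = _ := by ring

lemma gk_bound {s : ℝ} (hs : 0 < s) (N : ℕ) (hN : 1 ≤ N) (x : ℝ) (n : ℕ) (hn : n ≤ N) :
    |gk n s x| ≤ sg N s ^ n * ((4 * π * s) ^ (-(1:ℝ) / 2) * Real.exp (-x ^ 2 / (8 * s))) := by
  refine (gk_bound1 hs N x n hn).trans ?_
  have hN0 : (0:ℝ) < N := by exact_mod_cast hN
  have hr : 0 < √(2 * s * N) := by positivity
  have hrr : √(2 * s * N) ^ 2 = 2 * s * N := Real.sq_sqrt (by positivity)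
  rw [sg, gk_zero]
  set r := √(2 * s * N)
  set a := |x| / r with ha
  have hx : |x| = a * r := by rw [ha]; field_simp
  have ha0 : 0 ≤ a := by positivity
  have hx2 : x ^ 2 = a ^ 2 * (2 * s * N) := by rw [← sq_abs, hx, mul_pow, hrr]
  have h1 : |x| + r ≤ r * Real.exp a := by
    rw [hx]; nlinarith [Real.add_one_le_exp a]
  have h2 : ((|x| + r) / (2 * s)) ^ n ≤ (r / (2 * s)) ^ n * Real.exp (n * a) := by
    rw [Real.exp_nat_mul, ← mul_pow]
    gcongr
    rw [div_mul_eq_mul_div]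
    gcongr
  have hnN : (n:ℝ) ≤ N := by exact_mod_cast hn
  have h3 : Real.exp (n * a) * Real.exp (-x ^ 2 / (4 * s)) ≤
      Real.exp 1 ^ n * Real.exp (-x ^ 2 / (8 * s)) := by
    rw [← Real.exp_nat_mul, ← Real.exp_add, ← Real.exp_add, Real.exp_le_exp, hx2]
    have e1 : -(a ^ 2 * (2 * s * N)) / (4 * s) = -(a^2 * N / 2) := by field_simp; ring
    have e2 : -(a ^ 2 * (2 * s * N)) / (8 * s) = -(a^2 * N / 4) := by field_simp; ring
    rw [e1, e2]
    have hn0 : (0:ℝ) ≤ n := by positivity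
    nlinarith [mul_nonneg hn0 (sq_nonneg (a - 2)), mul_nonneg (sub_nonneg.2 hnN) (sq_nonneg a)]
  calc _ ≤ ((r / (2 * s)) ^ n * Real.exp (n * a)) * ((4 * π * s) ^ (-(1:ℝ) / 2) * Real.exp (-x ^ 2 / (4 * s))) := by gcongr
    _ = (r / (2 * s)) ^ n * (4 * π * s) ^ (-(1:ℝ) / 2) * (Real.exp (n * a) * Real.exp (-x ^ 2 / (4 * s))) := by ring
    _ ≤ (r / (2 * s)) ^ n * (4 * π * s) ^ (-(1:ℝ) / 2) * (Real.exp 1 ^ n * Real.exp (-x ^ 2 / (8 * s))) := by gcongr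
    _ = _ := by rw [mul_pow]; ring

/-- d-dim kernel -/
def Kd {d : ℕ} (γ : Fin d → ℕ) (s : ℝ) (x : Euc d) : ℝ := ∏ i, gk (γ i) s (x i)

def Hk (d : ℕ) (s : ℝ) (x : Euc d) : ℝ :=
  (4 * π * s) ^ (-(d:ℝ) / 2) * Real.exp (-‖x‖ ^ 2 / (8 * s))

lemma prod_gauss {d : ℕ} {s : ℝ} (hs : 0 < s) (c : ℝ) (x : Euc d) :
    ∏ i, ((4 * π * s) ^ (-(1:ℝ) / 2) * Real.exp (-(x i) ^ 2 / c)) =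
      (4 * π * s) ^ (-(d:ℝ) / 2) * Real.exp (-‖x‖ ^ 2 / c) := by
  rw [Finset.prod_mul_distrib, ← Real.exp_sum, Finset.prod_const, ← Real.rpow_natCast,
    ← Real.rpow_mul (by positivity), EuclideanSpace.real_norm_sq_eq]
  congr 2
  · simp; ring
  · rw [← Finset.sum_neg_distrib, Finset.sum_div]

lemma Kd_zero {d : ℕ} {s : ℝ} (hs : 0 < s) (x : Euc d) : Kd 0 s x = heatKernel d s x := by
  simp only [Kd, Pi.zero_apply, gk_zero, heatKernel]
  exact prod_gauss hs _ x

lemma Kd_bound {d : ℕ} {s : ℝ} (hs : 0 < s) (N : ℕ) (hN : 1 ≤ N) (γ : Fin d → ℕ)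
    (hγ : msize γ ≤ N) (x : Euc d) : |Kd γ s x| ≤ sg N s ^ (msize γ) * Hk d s x := by
  rw [Kd, Finset.abs_prod, Hk, ← prod_gauss hs, msize, ← Finset.prod_pow_eq_pow_sum,
    ← Finset.prod_mul_distrib]
  refine Finset.prod_le_prod (fun _ _ => abs_nonneg _) fun i _ => ?_
  refine gk_bound hs N hN _ _ (le_trans ?_ hγ)
  exact Finset.single_le_sum (f := γ) (fun _ _ => Nat.zero_le _) (Finset.mem_univ i)

lemma Kd_update {d : ℕ} (γ : Fin d → ℕ) (s : ℝ) (x : Euc d) (i : Fin d) (n : ℕ) :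
    (∏ j ∈ Finset.univ.erase i, gk (γ j) s (x j)) * gk (γ i + n) s (x i) =
      Kd (γ + Pi.single i n) s x := by
  rw [Kd, ← Finset.prod_erase_mul _ _ (Finset.mem_univ i)]
  congr 1
  · refine Finset.prod_congr rfl fun j hj => ?_
    simp [Pi.single_eq_of_ne (Finset.ne_of_mem_erase hj)]
  · simp

lemma Kd_hasDerivAt_s {d : ℕ} (γ : Fin d → ℕ) {s : ℝ} (hs : 0 < s) (x : Euc d) :
    HasDerivAt (fun s => Kd γ s x) (∑ i, Kd (γ + Pi.single i 2) s x) s := by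
  have := HasDerivAt.fun_finsetProd (u := Finset.univ) (f := fun i s => gk (γ i) s (x i))
    (f' := fun i => gk (γ i + 2) s (x i)) (x := s) (fun i _ => gk_hasDerivAt_s hs _ _)
  refine HasDerivAt.congr_deriv this ?_
  simp [Kd_update, smul_eq_mul]

lemma Kd_hasFDerivAt {d : ℕ} (γ : Fin d → ℕ) {s : ℝ} (hs : 0 < s) (x : Euc d) :
    HasFDerivAt (fun x => Kd γ s x)
      (∑ i, Kd (γ + Pi.single i 1) s x • (EuclideanSpace.proj i : Euc d →L[ℝ] ℝ)) x := by
  have := HasFDerivAt.finsetProd (u := Finset.univ) (g := fun i (x : Euc d) => gk (γ i) s (x i))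
    (g' := fun i => gk (γ i + 1) s (x i) • (EuclideanSpace.proj i : Euc d →L[ℝ] ℝ)) (x := x)
    (fun i _ => (gk_hasDerivAt_x hs (γ i) (x i)).comp_hasFDerivAt x
      (EuclideanSpace.proj i : Euc d →L[ℝ] ℝ).hasFDerivAt)
  refine HasFDerivAt.congr_fderiv this ?_
  simp [Kd_update, smul_smul]

lemma Kd_continuous {d : ℕ} (γ : Fin d → ℕ) {s : ℝ} (hs : 0 < s) :
    Continuous (fun x : Euc d => Kd γ s x) :=
  continuous_iff_continuousAt.2 fun x => (Kd_hasFDerivAt γ hs x).continuousAt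

lemma Kd_unif {d : ℕ} (γ : Fin d → ℕ) {t : ℝ} (ht : 0 < t) :
    ∃ C : ℝ, 0 ≤ C ∧ ∀ s, t ≤ s → ∀ x : Euc d, |Kd γ s x| ≤ C := by
  refine ⟨sg (msize γ + 1) t ^ (msize γ) * (4 * π * t) ^ (-(d:ℝ) / 2), by unfold sg; positivity,
    fun s hs x => ?_⟩
  have hs0 : 0 < s := ht.trans_le hs
  refine (Kd_bound hs0 (msize γ + 1) (by omega) γ (by omega) x).trans ?_
  have h1 : sg (msize γ + 1) s ≤ sg (msize γ + 1) t := by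
    unfold sg
    have e : ∀ u : ℝ, 0 < u → √(2 * u * ((msize γ + 1 : ℕ):ℝ)) / (2 * u)
        = √(((msize γ + 1 : ℕ):ℝ)) / √(2 * u) := by
      intro u hu
      have h := Real.mul_self_sqrt (by positivity : (0:ℝ) ≤ 2 * u)
      rw [Real.sqrt_mul (by positivity)]
      rw [div_eq_div_iff (by positivity) (by positivity)]
      linear_combination (√(((msize γ + 1 : ℕ):ℝ))) * h
    rw [e s hs0, e t ht]
    gcongr
  have h2 : Hk d s x ≤ (4 * π * t) ^ (-(d:ℝ) / 2) := by
    unfold Hk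
    have : Real.exp (-‖x‖ ^ 2 / (8 * s)) ≤ 1 := by
      rw [Real.exp_le_one_iff]
      apply div_nonpos_of_nonpos_of_nonneg <;> [(simp; done); positivity]
    calc _ ≤ (4 * π * s) ^ (-(d:ℝ) / 2) * 1 := by gcongr
      _ ≤ _ := by
        rw [mul_one]
        apply Real.rpow_le_rpow_of_nonpos (by positivity) (by gcongr)
        have : (0:ℝ) ≤ d := by positivity
        linarith
  have : 0 ≤ sg (msize γ + 1) s := by unfold sg; positivity
  have : 0 ≤ Hk d s x := by unfold Hk; positivity
  have : 0 ≤ sg (msize γ + 1) t := by unfold sg; positivity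
  gcongr

def Ud {d : ℕ} (f : Euc d → ℝ) (γ : Fin d → ℕ) (s : ℝ) (x : Euc d) : ℝ :=
  ∫ y, f y * Kd γ s (x - y)

lemma Kd_int {d : ℕ} {f : Euc d → ℝ} (hf : Integrable f) (γ : Fin d → ℕ) {s : ℝ} (hs : 0 < s)
    (x : Euc d) : Integrable (fun y => f y * Kd γ s (x - y)) := by
  obtain ⟨C, _, hC⟩ := Kd_unif γ hs
  refine hf.mul_bdd (c := C) ?_ (Eventually.of_forall fun y => hC s le_rfl _)
  exact ((Kd_continuous γ hs).comp (continuous_const.sub continuous_id)).aestronglyMeasurable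

lemma Ud_hasDerivAt_s {d : ℕ} {f : Euc d → ℝ} (hf : Integrable f) (γ : Fin d → ℕ) {s : ℝ}
    (hs : 0 < s) (x : Euc d) :
    HasDerivAt (fun s => Ud f γ s x) (∑ i, Ud f (γ + Pi.single i 2) s x) s := by
  choose C hC0 hC using fun i : Fin d => Kd_unif (γ + Pi.single i 2) (half_pos hs)
  have hnb : Set.Ioi (s/2) ∈ 𝓝 s := Ioi_mem_nhds (by linarith)
  have := (hasDerivAt_integral_of_dominated_loc_of_deriv_le (μ := volume)
    (F := fun s y => f y * Kd γ s (x - y)) (x₀ := s) (bound := fun y => |f y| * ∑ i, C i)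
    (F' := fun s y => f y * ∑ i, Kd (γ + Pi.single i 2) s (x - y)) hnb ?_ ?_ ?_ ?_ ?_ ?_).2
  · refine HasDerivAt.congr_deriv this ?_
    simp only [Ud, Finset.mul_sum]
    rw [integral_finsetSum]
    intro i _
    exact Kd_int hf _ hs x
  · filter_upwards [hnb] with u hu
    exact (Kd_int hf γ (by have := Set.mem_Ioi.1 hu; linarith) x).aestronglyMeasurable
  · exact Kd_int hf γ hs x
  · simp only [Finset.mul_sum]
    exact (integrable_finsetSum _ fun i _ => Kd_int hf _ hs x).aestronglyMeasurable
  · refine Eventually.of_forall fun y u hu => ?_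
    rw [norm_mul, Real.norm_eq_abs]
    gcongr
    refine (norm_sum_le _ _).trans (Finset.sum_le_sum fun i _ => hC i u (le_of_lt hu) _)
  · exact hf.abs.mul_const _
  · refine Eventually.of_forall fun y u hu => ?_
    exact (Kd_hasDerivAt_s γ (by have := Set.mem_Ioi.1 hu; linarith) _).const_mul _

lemma Ud_hasFDerivAt {d : ℕ} {f : Euc d → ℝ} (hf : Integrable f) (γ : Fin d → ℕ) {s : ℝ}
    (hs : 0 < s) (x : Euc d) :
    HasFDerivAt (fun x => Ud f γ s x)
      (∑ i, Ud f (γ + Pi.single i 1) s x • (EuclideanSpace.proj i : Euc d →L[ℝ] ℝ)) x := by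
  choose C hC0 hC using fun i : Fin d => Kd_unif (γ + Pi.single i 1) hs
  have hint : ∀ i : Fin d, Integrable (fun y => (f y * Kd (γ + Pi.single i 1) s (x - y)) •
      (EuclideanSpace.proj i : Euc d →L[ℝ] ℝ)) := fun i => (Kd_int hf _ hs x).smul_const _
  have e : ∀ (x y : Euc d), f y • ∑ i, Kd (γ + Pi.single i 1) s (x - y) •
      (EuclideanSpace.proj i : Euc d →L[ℝ] ℝ) = ∑ i, (f y * Kd (γ + Pi.single i 1) s (x - y)) •
      (EuclideanSpace.proj i : Euc d →L[ℝ] ℝ) := by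
    intro x y; simp [Finset.smul_sum, smul_smul]
  have := (hasFDerivAt_integral_of_dominated_of_fderiv_le (μ := volume) (𝕜 := ℝ)
    (F := fun x y => f y * Kd γ s (x - y)) (x₀ := x) (s := Set.univ)
    (bound := fun y => |f y| * ∑ i, C i * ‖(EuclideanSpace.proj i : Euc d →L[ℝ] ℝ)‖)
    (F' := fun x y => f y • ∑ i, Kd (γ + Pi.single i 1) s (x - y) •
      (EuclideanSpace.proj i : Euc d →L[ℝ] ℝ)) univ_mem ?_ ?_ ?_ ?_ ?_ ?_)
  · refine HasFDerivAt.congr_fderiv this ?_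
    simp only [e]
    rw [integral_finsetSum _ (fun i _ => hint i)]
    refine Finset.sum_congr rfl fun i _ => ?_
    rw [integral_smul_const]; rfl
  · exact Eventually.of_forall fun u => (Kd_int hf γ hs u).aestronglyMeasurable
  · exact Kd_int hf γ hs x
  · simp only [e]
    exact Finset.aestronglyMeasurable_fun_sum _ fun i _ => (hint i).aestronglyMeasurable
  · refine Eventually.of_forall fun y u _ => ?_
    rw [norm_smul, Real.norm_eq_abs]
    gcongr
    refine (norm_sum_le _ _).trans (Finset.sum_le_sum fun i _ => ?_)
    rw [norm_smul]
    gcongr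
    exact hC i s le_rfl _
  · exact hf.abs.mul_const _
  · refine Eventually.of_forall fun y u _ => ?_
    have h := (Kd_hasFDerivAt γ hs (u - y)).comp u ((hasFDerivAt_id u).sub_const y)
    exact (h.const_mul (f y))

abbrev Tm (d : ℕ) : Type := Euc d × ℕ × (Fin d → ℕ)

def ev1 {d : ℕ} (f : Euc d → ℝ) (T : Tm d) (s : ℝ) (x : Euc d) : Euc d :=
  (s ^ T.2.1 * Ud f T.2.2 s x) • T.1

def ev {d : ℕ} (f : Euc d → ℝ) (S : List (Tm d)) (s : ℝ) (x : Euc d) : Euc d :=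
  (S.map (fun T => ev1 f T s x)).sum

def dT {d : ℕ} (T : Tm d) : List (Tm d) :=
  ((T.2.1 : ℝ) • T.1, T.2.1 - 1, T.2.2) ::
    (List.finRange d).map fun i => (T.1, T.2.1, T.2.2 + Pi.single i 2)

def dS {d : ℕ} (S : List (Tm d)) : List (Tm d) := S.flatMap dT

def xS {d : ℕ} (i : Fin d) (S : List (Tm d)) : List (Tm d) :=
  S.map fun T => (T.1, T.2.1, T.2.2 + Pi.single i 1)

lemma ev_nil {d : ℕ} (f : Euc d → ℝ) (s : ℝ) (x : Euc d) : ev f [] s x = 0 := rfl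

lemma ev_cons {d : ℕ} (f : Euc d → ℝ) (T : Tm d) (S : List (Tm d)) (s : ℝ) (x : Euc d) :
    ev f (T :: S) s x = ev1 f T s x + ev f S s x := by simp [ev]

lemma ev_append {d : ℕ} (f : Euc d → ℝ) (S S' : List (Tm d)) (s : ℝ) (x : Euc d) :
    ev f (S ++ S') s x = ev f S s x + ev f S' s x := by simp [ev]

lemma ev1_hasDerivAt {d : ℕ} {f : Euc d → ℝ} (hf : Integrable f) (T : Tm d) {s : ℝ}
    (hs : 0 < s) (x : Euc d) :
    HasDerivAt (fun s => ev1 f T s x) (ev f (dT T) s x) s := by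
  have h := ((hasDerivAt_pow T.2.1 s).mul (Ud_hasDerivAt_s hf T.2.2 hs x)).smul_const T.1
  refine HasDerivAt.congr_deriv h ?_
  rw [dT, ev_cons, ev, List.map_map, ev1, ← Fin.sum_univ_def]
  simp only [Function.comp_def, ev1, ← Finset.sum_smul, ← Finset.mul_sum, smul_smul, ← add_smul]
  congr 1
  ring

lemma ev_hasDerivAt {d : ℕ} {f : Euc d → ℝ} (hf : Integrable f) (S : List (Tm d)) {s : ℝ}
    (hs : 0 < s) (x : Euc d) :
    HasDerivAt (fun s => ev f S s x) (ev f (dS S) s x) s := by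
  induction S with
  | nil => simpa [ev, dS] using hasDerivAt_const s (0 : Euc d)
  | cons T S ih =>
    have : dS (T :: S) = dT T ++ dS S := by simp [dS]
    rw [this, ev_append]
    simp only [ev_cons]
    exact (ev1_hasDerivAt hf T hs x).add ih

lemma ev_iter {d : ℕ} {f : Euc d → ℝ} (hf : Integrable f) (S : List (Tm d)) (k : ℕ) {t : ℝ}
    (ht : 0 < t) (x : Euc d) :
    iteratedDeriv k (fun s => ev f S s x) t = ev f (dS^[k] S) t x := by
  induction k generalizing t with
  | zero => simp
  | succ k ih =>
    rw [iteratedDeriv_succ, Function.iterate_succ_apply']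
    have : iteratedDeriv k (fun s => ev f S s x) =ᶠ[𝓝 t] fun s => ev f (dS^[k] S) s x := by
      filter_upwards [Ioi_mem_nhds ht] with s hs using ih hs
    rw [this.deriv_eq]
    exact (ev_hasDerivAt hf _ ht x).deriv

lemma ev_fderiv {d : ℕ} {f : Euc d → ℝ} (hf : Integrable f) (S : List (Tm d)) {s : ℝ}
    (hs : 0 < s) (x : Euc d) :
    ∃ L : Euc d →L[ℝ] Euc d, HasFDerivAt (fun x => ev f S s x) L x ∧
      ∀ i, L (EuclideanSpace.single i 1) = ev f (xS i S) s x := by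
  induction S with
  | nil =>
    refine ⟨0, ?_, fun i => by simp [ev, xS]⟩
    simpa [ev] using hasFDerivAt_const (0 : Euc d) x
  | cons T S ih =>
    obtain ⟨L, hL, hi⟩ := ih
    have h1 := ((Ud_hasFDerivAt hf T.2.2 hs x).const_mul (s ^ T.2.1)).smul_const T.1
    refine ⟨_, ((h1.add hL).congr_of_eventuallyEq
      (Eventually.of_forall fun x => ?_)), fun i => ?_⟩
    · exact ev_cons f T S s x
    · have : xS i (T :: S) = (T.1, T.2.1, T.2.2 + Pi.single i 1) :: xS i S := by simp [xS]
      rw [this, ev_cons, _root_.add_apply, hi]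
      congr 1
      simp [ev1]

lemma pd_ev {d : ℕ} {f : Euc d → ℝ} (hf : Integrable f) (S : List (Tm d)) {s : ℝ}
    (hs : 0 < s) (i : Fin d) : pd i (ev f S s) = ev f (xS i S) s := by
  funext x
  obtain ⟨L, hL, hi⟩ := ev_fderiv hf S hs x
  rw [pd, ← hi i]
  exact congrArg (fun L : Euc d →L[ℝ] Euc d => L (EuclideanSpace.single i 1)) hL.fderiv

lemma pd_iter_ev {d : ℕ} {f : Euc d → ℝ} (hf : Integrable f) (S : List (Tm d)) {s : ℝ}
    (hs : 0 < s) (i : Fin d) (n : ℕ) : (pd i)^[n] (ev f S s) = ev f ((xS i)^[n] S) s := by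
  induction n generalizing S with
  | zero => rfl
  | succ n ih => rw [Function.iterate_succ_apply, Function.iterate_succ_apply, pd_ev hf S hs, ih]

lemma foldr_ev {d : ℕ} {f : Euc d → ℝ} (hf : Integrable f) (S : List (Tm d)) {s : ℝ}
    (hs : 0 < s) (β : Fin d → ℕ) (l : List (Fin d)) :
    l.foldr (fun i g => (pd i)^[β i] g) (ev f S s) =
      ev f (l.foldr (fun i S => (xS i)^[β i] S) S) s := by
  induction l with
  | nil => rfl
  | cons i l ih => rw [List.foldr_cons, List.foldr_cons, ih, pd_iter_ev hf _ hs]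

def wt {d : ℕ} (N : ℕ) (t : ℝ) (S : List (Tm d)) : ℝ :=
  (S.map fun T => ‖T.1‖ * (t ^ T.2.1 * sg N t ^ msize T.2.2)).sum

/-- bookkeeping predicate -/
def Bd {d : ℕ} (N : ℕ) (t : ℝ) (m n : ℕ) (w : ℝ) (S : List (Tm d)) : Prop :=
  (∀ T ∈ S, T.2.1 ≤ m ∧ msize T.2.2 ≤ n) ∧ wt N t S ≤ w

lemma msize_add {d : ℕ} (γ : Fin d → ℕ) (i : Fin d) (n : ℕ) :
    msize (γ + Pi.single i n) = msize γ + n := by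
  simp [msize, Finset.sum_add_distrib]

lemma sg_nonneg (N : ℕ) {t : ℝ} (ht : 0 < t) : 0 ≤ sg N t := by unfold sg; positivity

lemma Bd_xS {d : ℕ} {N : ℕ} {t : ℝ} (ht : 0 < t) {m n : ℕ} {w : ℝ} {S : List (Tm d)}
    (h : Bd N t m n w S) (i : Fin d) : Bd N t m (n+1) (sg N t * w) (xS i S) := by
  refine ⟨?_, ?_⟩
  · intro T hT
    obtain ⟨T', hT', rfl⟩ := List.mem_map.1 hT
    have := h.1 T' hT'
    simp only [msize_add]
    omega
  · refine le_trans (le_of_eq ?_) (mul_le_mul_of_nonneg_left h.2 (sg_nonneg N ht))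
    rw [wt, wt, xS, List.map_map, ← List.sum_map_mul_left]
    congr 1
    refine List.map_congr_left fun T _ => ?_
    simp only [Function.comp, msize_add]
    ring

lemma Bd_xS_iter {d : ℕ} {N : ℕ} {t : ℝ} (ht : 0 < t) {m n : ℕ} {w : ℝ} {S : List (Tm d)}
    (h : Bd N t m n w S) (i : Fin d) (j : ℕ) :
    Bd N t m (n+j) (sg N t ^ j * w) ((xS i)^[j] S) := by
  induction j with
  | zero => simpa using h
  | succ j ih =>
    rw [Function.iterate_succ_apply', pow_succ', mul_assoc]
    exact Bd_xS ht ih i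

lemma Bd_foldr {d : ℕ} {N : ℕ} {t : ℝ} (ht : 0 < t) {m n : ℕ} {w : ℝ} {S : List (Tm d)}
    (h : Bd N t m n w S) (β : Fin d → ℕ) (l : List (Fin d)) :
    Bd N t m (n + (l.map β).sum) (sg N t ^ (l.map β).sum * w)
      (l.foldr (fun i S => (xS i)^[β i] S) S) := by
  induction l with
  | nil => simpa using h
  | cons i l ih =>
    have := Bd_xS_iter ht ih i (β i)
    rw [List.foldr_cons, List.map_cons, List.sum_cons, pow_add, mul_assoc]
    rw [add_comm (β i), ← add_assoc]
    exact this

lemma wt_dT {d : ℕ} {N : ℕ} {t : ℝ} (ht : 0 < t) {m : ℕ} {T : Tm d} (h : T.2.1 ≤ m) :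
    wt N t (dT T) ≤ (m / t + d * sg N t ^ 2) * (‖T.1‖ * (t ^ T.2.1 * sg N t ^ msize T.2.2)) := by
  rw [wt, dT, List.map_cons, List.sum_cons, List.map_map, ← Fin.sum_univ_def]
  simp only [Function.comp, msize_add, Finset.sum_const, Finset.card_univ, Fintype.card_fin,
    nsmul_eq_mul]
  rw [add_mul]
  have hs := sg_nonneg N ht
  refine add_le_add ?_ (le_of_eq (by ring))
  rw [norm_smul, Real.norm_natCast]
  have h1 : (T.2.1 : ℝ) * t ^ (T.2.1 - 1) ≤ m / t * t ^ T.2.1 := by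
    have hm : (T.2.1 : ℝ) ≤ m := by exact_mod_cast h
    rcases Nat.eq_zero_or_pos T.2.1 with h0 | h0
    · rw [h0]; simp; positivity
    · have : t ^ T.2.1 = t ^ (T.2.1 - 1) * t := by rw [← pow_succ]; congr 1; omega
      rw [this]
      have : (m:ℝ) / t * (t ^ (T.2.1 - 1) * t) = m * t ^ (T.2.1 - 1) := by field_simp
      rw [this]
      gcongr
  calc _ = ((T.2.1 : ℝ) * t ^ (T.2.1 - 1)) * (‖T.1‖ * sg N t ^ msize T.2.2) := by ring
    _ ≤ (m / t * t ^ T.2.1) * (‖T.1‖ * sg N t ^ msize T.2.2) := by gcongr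
    _ = _ := by ring

lemma Bd_dS {d : ℕ} {N : ℕ} {t : ℝ} (ht : 0 < t) {m n : ℕ} {w : ℝ} {S : List (Tm d)}
    (h : Bd N t m n w S) : Bd N t m (n+2) ((m / t + d * sg N t ^ 2) * w) (dS S) := by
  refine ⟨?_, ?_⟩
  · intro T hT
    obtain ⟨T', hT', h2⟩ := List.mem_flatMap.1 hT
    have := h.1 T' hT'
    rcases List.mem_cons.1 h2 with rfl | h2
    · simp only; omega
    · obtain ⟨i, _, rfl⟩ := List.mem_map.1 h2
      simp only [msize_add]
      omega
  · refine le_trans ?_ (mul_le_mul_of_nonneg_left h.2 (by positivity))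
    have h1 := h.1
    clear h
    induction S with
    | nil => simp [wt, dS]
    | cons T S ih =>
      have e1 : wt N t (dS (T :: S)) = wt N t (dT T) + wt N t (dS S) := by simp [dS, wt]
      have e2 : wt N t (T :: S) = ‖T.1‖ * (t ^ T.2.1 * sg N t ^ msize T.2.2) + wt N t S := by
        simp [wt]
      rw [e1, e2, mul_add]
      exact add_le_add (wt_dT ht (h1 T (by simp)).1) (ih fun T hT => h1 T (by simp [hT]))

lemma Bd_dS_iter {d : ℕ} {N : ℕ} {t : ℝ} (ht : 0 < t) {m n : ℕ} {w : ℝ} {S : List (Tm d)}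
    (h : Bd N t m n w S) (k : ℕ) :
    Bd N t m (n+2*k) ((m / t + d * sg N t ^ 2) ^ k * w) (dS^[k] S) := by
  induction k with
  | zero => simpa using h
  | succ k ih =>
    rw [Function.iterate_succ_apply', pow_succ', mul_assoc]
    exact Bd_dS ht ih

def S0 (d m : ℕ) : List (Tm d) :=
  (List.finRange d).map fun i => (EuclideanSpace.single i 1, m, Pi.single i 1)

lemma msize_single {d : ℕ} (i : Fin d) (n : ℕ) : msize (Pi.single i n : Fin d → ℕ) = n := by
  simp [msize]

lemma Bd_S0 {d : ℕ} {N : ℕ} {t : ℝ} (m : ℕ) :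
    Bd N t m 1 (d * (t ^ m * sg N t)) (S0 d m) := by
  refine ⟨?_, ?_⟩
  · intro T hT
    obtain ⟨i, _, rfl⟩ := List.mem_map.1 hT
    simp [msize_single]
  · rw [wt, S0, List.map_map, ← Fin.sum_univ_def]
    simp [msize_single]

lemma gradHeat_eq {d : ℕ} {s : ℝ} (hs : 0 < s) (x : Euc d) :
    gradHeat d s x = ∑ i, Kd (Pi.single i 1) s x • (EuclideanSpace.single i 1 : Euc d) := by
  rw [gradHeat]
  apply HasGradientAt.gradient
  rw [hasGradientAt_iff_hasFDerivAt]
  have h := Kd_hasFDerivAt (0 : Fin d → ℕ) hs x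
  have e : (fun x => Kd (0 : Fin d → ℕ) s x) = fun x => heatKernel d s x := by
    funext x; exact Kd_zero hs x
  rw [e] at h
  refine HasFDerivAt.congr_fderiv h ?_
  ext v
  simp [EuclideanSpace.inner_single_left]

lemma convV_eq {d : ℕ} {f : Euc d → ℝ} (hf : Integrable f) (m : ℕ) {s : ℝ} (hs : 0 < s)
    (x : Euc d) : s ^ m • convV (gradHeat d s) f x = ev f (S0 d m) s x := by
  rw [ev, S0, List.map_map, ← Fin.sum_univ_def, convV]
  simp only [Function.comp_def, ev1, gradHeat_eq hs, Finset.smul_sum, smul_smul]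
  rw [integral_finsetSum, Finset.smul_sum]
  · refine Finset.sum_congr rfl fun i _ => ?_
    rw [integral_smul_const, smul_smul]; rfl
  · intro i _
    exact (Kd_int hf _ hs x).smul_const _

lemma target_eq {d : ℕ} {f : Euc d → ℝ} (hf : Integrable f) (β : Fin d → ℕ) (k m : ℕ) {t : ℝ}
    (ht : 0 < t) :
    mderiv β (tderiv k (fun s x => s ^ m • convV (gradHeat d s) f x) t) =
      ev f ((List.finRange d).foldr (fun i S => (xS i)^[β i] S) (dS^[k] (S0 d m))) t := by
  have : tderiv k (fun s x => s ^ m • convV (gradHeat d s) f x) t = ev f (dS^[k] (S0 d m)) t := by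
    funext x
    rw [tderiv, ← ev_iter hf _ _ ht]
    apply Filter.EventuallyEq.iteratedDeriv_eq
    filter_upwards [Ioi_mem_nhds ht] with s hs using convV_eq hf m hs x
  rw [this, mderiv, foldr_ev hf _ ht]

lemma Hk_nonneg {d : ℕ} {t : ℝ} (ht : 0 < t) (x : Euc d) : 0 ≤ Hk d t x := by
  unfold Hk; positivity

lemma Ud_bound {d : ℕ} {f : Euc d → ℝ} {N : ℕ} (hN : 1 ≤ N) {t : ℝ}
    (ht : 0 < t) {γ : Fin d → ℕ} (hγ : msize γ ≤ N) (x : Euc d) :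
    ‖Ud f γ t x‖ₑ ≤ ENNReal.ofReal (sg N t ^ msize γ) *
      ∫⁻ y, ‖f y‖ₑ * ENNReal.ofReal (Hk d t (x - y)) := by
  refine (enorm_integral_le_lintegral_enorm _).trans ?_
  rw [← lintegral_const_mul' _ _ ENNReal.ofReal_ne_top]
  refine lintegral_mono fun y => ?_
  rw [enorm_mul, mul_left_comm]
  gcongr
  rw [← ENNReal.ofReal_mul (pow_nonneg (sg_nonneg N ht) _), Real.enorm_eq_ofReal_abs]
  exact ENNReal.ofReal_le_ofReal (Kd_bound ht N hN γ hγ _)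

lemma ev_bound {d : ℕ} {f : Euc d → ℝ} {N : ℕ} (hN : 1 ≤ N) {t : ℝ}
    (ht : 0 < t) {m n : ℕ} (hn : n ≤ N) {w : ℝ} {S : List (Tm d)} (h : Bd N t m n w S)
    (x : Euc d) :
    ‖ev f S t x‖ₑ ≤ ENNReal.ofReal w *
      ∫⁻ y, ‖f y‖ₑ * ENNReal.ofReal (Hk d t (x - y)) := by
  have hs := sg_nonneg N ht
  refine le_trans ?_ (mul_le_mul_left (ENNReal.ofReal_le_ofReal h.2) _)
  have h1 := h.1
  clear h
  induction S with
  | nil => simp [ev, wt]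
  | cons T S ih =>
    have e2 : wt N t (T :: S) = ‖T.1‖ * (t ^ T.2.1 * sg N t ^ msize T.2.2) + wt N t S := by
      simp [wt]
    have hw : 0 ≤ wt N t S := by
      apply List.sum_nonneg
      intro a ha
      obtain ⟨T, _, rfl⟩ := List.mem_map.1 ha
      positivity
    rw [ev_cons, e2, ENNReal.ofReal_add (by positivity) hw, add_mul]
    refine (enorm_add_le _ _).trans (add_le_add ?_ (ih fun T hT => h1 T (by simp [hT])))
    rw [ev1, enorm_smul, enorm_mul, mul_comm, ENNReal.ofReal_mul (by positivity), ofReal_norm,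
      mul_assoc, ENNReal.ofReal_mul (by positivity), mul_assoc, Real.enorm_eq_ofReal (by positivity)]
    gcongr
    exact Ud_bound hN ht ((h1 T (by simp)).2.trans hn) x

lemma Hk_lintegral {d : ℕ} {t : ℝ} (ht : 0 < t) :
    ∫⁻ x : Euc d, ENNReal.ofReal (Hk d t x) ≤ ENNReal.ofReal (2 ^ d) := by
  have hb : 0 < 1 / (8 * t) := by positivity
  have h1 := GaussianFourier.integral_rexp_neg_mul_sq_norm (V := Euc d) hb
  have h2 : Integrable (fun v : Euc d => Real.exp (-(1 / (8 * t)) * ‖v‖ ^ 2)) := by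
    by_contra h
    rw [integral_undef h] at h1
    have : 0 < (π / (1 / (8 * t))) ^ ((Module.finrank ℝ (Euc d) : ℝ) / 2) := by positivity
    linarith
  have e : (fun x : Euc d => Hk d t x) = fun v : Euc d =>
      (4 * π * t) ^ (-(d:ℝ) / 2) * Real.exp (-(1 / (8 * t)) * ‖v‖ ^ 2) := by
    funext v; unfold Hk; congr 2; ring
  have h3 : Integrable (fun x : Euc d => Hk d t x) := by rw [e]; exact h2.const_mul _
  rw [← ofReal_integral_eq_lintegral_ofReal h3 (Eventually.of_forall fun x => Hk_nonneg ht x)]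
  apply ENNReal.ofReal_le_ofReal
  rw [e, integral_const_mul, h1]
  have e2 : π / (1 / (8 * t)) = 2 * (4 * π * t) := by field_simp; ring
  rw [e2, finrank_euclideanSpace_fin, Real.mul_rpow (x := 2) (y := 4 * π * t) (by positivity) (by positivity), mul_left_comm,
    ← Real.rpow_add (by positivity), neg_div, neg_add_cancel, Real.rpow_zero, mul_one,
    ← Real.rpow_natCast]
  apply Real.rpow_le_rpow_of_exponent_le (by norm_num)
  have : (0:ℝ) ≤ d := by positivity
  linarith

lemma Hk_le {d : ℕ} {t : ℝ} (ht : 0 < t) (x : Euc d) : Hk d t x ≤ t ^ (-(d:ℝ) / 2) := by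
  unfold Hk
  have : Real.exp (-‖x‖ ^ 2 / (8 * t)) ≤ 1 := by
    rw [Real.exp_le_one_iff]
    apply div_nonpos_of_nonpos_of_nonneg <;> [(simp; done); positivity]
  calc _ ≤ (4 * π * t) ^ (-(d:ℝ) / 2) * 1 := by gcongr
    _ ≤ _ := by
      rw [mul_one]
      apply Real.rpow_le_rpow_of_nonpos (by positivity)
      · nlinarith [Real.pi_gt_three]
      · have : (0:ℝ) ≤ d := by positivity
        linarith

lemma young {d : ℕ} {f : Euc d → ℝ} (hf : Integrable f) {t : ℝ} (ht : 0 < t) (W : ℝ≥0∞)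
    (u : Euc d → Euc d)
    (hu : ∀ x, ‖u x‖ₑ ≤ W * ∫⁻ y, ‖f y‖ₑ * ENNReal.ofReal (Hk d t (x - y)))
    (q : ℝ≥0∞) (hq : 1 ≤ q) :
    eLpNorm u q volume ≤ ENNReal.ofReal (2 ^ d * t ^ (-((d:ℝ) / 2 * (1 - q⁻¹.toReal)))) *
      (W * eLpNorm f 1 volume) := by
  set F := eLpNorm f 1 volume with hF
  have hF' : F = ∫⁻ y, ‖f y‖ₑ := by rw [hF, eLpNorm_one_eq_lintegral_enorm]
  set Z := W * F with hZ
  set B := ENNReal.ofReal (t ^ (-(d:ℝ) / 2)) with hB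
  have hc : Continuous (fun x : Euc d => Hk d t x) := by unfold Hk; fun_prop
  have hsup : ∀ x, ‖u x‖ₑ ≤ B * Z := by
    intro x
    refine (hu x).trans ?_
    rw [hZ, mul_left_comm]
    gcongr
    rw [hF', ← lintegral_const_mul' _ _ ENNReal.ofReal_ne_top]
    refine lintegral_mono fun y => ?_
    rw [mul_comm]
    gcongr
    exact Hk_le ht _
  have hone : ∫⁻ x, ‖u x‖ₑ ≤ ENNReal.ofReal (2 ^ d) * Z := by
    refine (lintegral_mono hu).trans ?_
    have hm : AEMeasurable (Function.uncurry fun x y : Euc d =>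
        ‖f y‖ₑ * ENNReal.ofReal (Hk d t (x - y))) (volume.prod volume) := by
      refine AEMeasurable.mul (f := fun z : Euc d × Euc d => ‖f z.2‖ₑ)
        (g := fun z : Euc d × Euc d => ENNReal.ofReal (Hk d t (z.1 - z.2))) ?_ ?_
      · exact (hf.aestronglyMeasurable.comp_snd).enorm
      · apply Measurable.aemeasurable
        exact ((hc.comp (continuous_fst.sub continuous_snd)).measurable).ennreal_ofReal
    have hm' : AEMeasurable (fun x : Euc d =>
        ∫⁻ y : Euc d, ‖f y‖ₑ * ENNReal.ofReal (Hk d t (x - y))) volume := hm.lintegral_prod_right'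
    rw [lintegral_const_mul'' _ hm', lintegral_lintegral_swap hm, hZ, mul_left_comm]
    gcongr
    rw [hF', ← lintegral_const_mul' _ _ ENNReal.ofReal_ne_top]
    refine lintegral_mono fun y => ?_
    rw [lintegral_const_mul' _ _ (by simp), mul_comm]
    gcongr
    refine le_trans (le_of_eq ?_) (Hk_lintegral (d := d) ht)
    exact lintegral_sub_right_eq_self (fun x => ENNReal.ofReal (Hk d t x)) y
  have h2 : (1:ℝ) ≤ 2 ^ d := one_le_pow₀ (by norm_num)
  clear_value Z
  rcases eq_or_ne q ⊤ with rfl | hqt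
  · rw [eLpNorm_exponent_top, eLpNormEssSup_eq_essSup_enorm]
    refine (essSup_le_of_ae_le _ (Eventually.of_forall hsup)).trans ?_
    gcongr
    apply ENNReal.ofReal_le_ofReal
    simp only [ENNReal.inv_top, ENNReal.toReal_zero, sub_zero, mul_one]
    rw [← neg_div]
    exact le_mul_of_one_le_left (by positivity) h2
  · have hq0 : q ≠ 0 := (lt_of_lt_of_le one_pos hq).ne'
    have hp : 1 ≤ q.toReal := by
      rw [← ENNReal.toReal_one]; exact ENNReal.toReal_mono hqt hq
    rw [eLpNorm_eq_lintegral_rpow_enorm_toReal hq0 hqt, ENNReal.toReal_inv]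
    set p := q.toReal
    have hp0 : 0 < p := by linarith
    have h3 : ∫⁻ x, ‖u x‖ₑ ^ p ≤ (B * Z) ^ (p - 1) * (ENNReal.ofReal (2 ^ d) * Z) := by
      calc ∫⁻ x, ‖u x‖ₑ ^ p ≤ ∫⁻ x, (B * Z) ^ (p - 1) * ‖u x‖ₑ := by
            refine lintegral_mono fun x => ?_
            have : ‖u x‖ₑ ^ p = ‖u x‖ₑ ^ (p - 1) * ‖u x‖ₑ := by
              conv_rhs => rw [← ENNReal.rpow_one ‖u x‖ₑ, ← ENNReal.rpow_mul,
                ← ENNReal.rpow_add_of_nonneg _ _ (by linarith) zero_le_one]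
              ring_nf
            rw [this]
            exact mul_le_mul_left (ENNReal.rpow_le_rpow (hsup x) (by linarith)) _
        _ ≤ _ := by
            rcases eq_or_ne ((B * Z) ^ (p - 1)) ⊤ with h | h
            · rw [h]
              rcases eq_or_ne Z 0 with h0 | h0
              · have : ∀ x, ‖u x‖ₑ = 0 := fun x => by simpa [h0] using hsup x
                simp [this]
              · rw [ENNReal.top_mul]
                · exact le_top
                · refine mul_ne_zero ?_ h0
                  simp
            · rw [lintegral_const_mul' _ _ h]
              gcongr
    calc _ ≤ ((B * Z) ^ (p - 1) * (ENNReal.ofReal (2 ^ d) * Z)) ^ (1 / p) := by gcongr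
      _ = B ^ (1 - p⁻¹) * ENNReal.ofReal (2 ^ d) ^ p⁻¹ * Z := by
        have e1 : (p - 1) * (1 / p) = 1 - p⁻¹ := by field_simp
        have h5 : 0 ≤ 1 - p⁻¹ := by
          have := inv_le_one_of_one_le₀ hp
          linarith
        rw [ENNReal.mul_rpow_of_nonneg _ _ (by positivity), ← ENNReal.rpow_mul, e1,
          ENNReal.mul_rpow_of_nonneg _ _ h5, one_div, ENNReal.mul_rpow_of_nonneg _ _ (by positivity)]
        have : Z = Z ^ (1 - p⁻¹) * Z ^ p⁻¹ := by
          rw [← ENNReal.rpow_add_of_nonneg _ _ h5 (by positivity)]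
          simp
        conv_rhs => rw [this]
        ring
      _ ≤ _ := by
        gcongr
        rw [hB, ENNReal.ofReal_rpow_of_pos (by positivity), ENNReal.ofReal_rpow_of_pos (by positivity),
          ← ENNReal.ofReal_mul (by positivity)]
        apply ENNReal.ofReal_le_ofReal
        rw [mul_comm, ← Real.rpow_mul ht.le]
        have : (2 ^ d : ℝ) ^ p⁻¹ ≤ 2 ^ d := by
          conv_rhs => rw [← Real.rpow_one ((2:ℝ) ^ d)]
          exact Real.rpow_le_rpow_of_exponent_le h2 (inv_le_one_of_one_le₀ hp)
        have e : -(d:ℝ) / 2 * (1 - p⁻¹) = -((d:ℝ) / 2 * (1 - p⁻¹)) := by ring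
        rw [e]
        gcongr

lemma sg_sq (N : ℕ) {t : ℝ} (ht : 0 < t) : sg N t ^ 2 = Real.exp 1 ^ 2 * N / (2 * t) := by
  unfold sg
  rw [mul_pow, div_pow, Real.sq_sqrt (by positivity)]
  field_simp

lemma final_num {d : ℕ} (hd : 1 ≤ d) {b k m : ℕ} (hbk : 0 < b + k) (hm : m ≤ k) {t : ℝ}
    (ht : 0 < t) {θ : ℝ} (hθ : 0 ≤ θ) :
    2 ^ d * t ^ (-θ) * (sg (b + 2 * k + 1) t ^ b * ((m / t + d * sg (b + 2 * k + 1) t ^ 2) ^ k *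
      (d * (t ^ m * sg (b + 2 * k + 1) t)))) ≤
    ((1 + d * (3 * Real.exp 1 ^ 2)) * (2 ^ d * d * √(1 + d * (3 * Real.exp 1 ^ 2))) ^ 2)
        ^ ((b:ℝ) / 2 + k) * ((b:ℝ) + k) ^ (((b:ℝ) + 1) / 2 + k + θ) *
      t ^ (-(((b:ℝ) + 2 * ((k:ℝ) - m) + 1) / 2) - θ) := by
  set N := b + 2 * k + 1
  have hd1 : (1:ℝ) ≤ d := by exact_mod_cast hd
  set A : ℝ := 1 + d * (3 * Real.exp 1 ^ 2) with hA
  have hA1 : 1 ≤ A := by rw [hA]; simp; positivity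
  have hA0 : 0 < A := by linarith
  set R : ℝ := (b:ℝ) + k with hR
  have hR1 : 1 ≤ R := by rw [hR]; exact_mod_cast hbk
  have hR0 : 0 < R := by linarith
  have hN : (N:ℝ) ≤ 3 * R := by
    have : N ≤ 3 * (b + k) := by omega
    rw [hR]; exact_mod_cast this
  have hs0 := sg_nonneg N ht
  have hs2 : sg N t ^ 2 ≤ 3 * Real.exp 1 ^ 2 * (R / t) := by
    rw [sg_sq N ht]
    rw [div_le_iff₀ (by positivity)]
    have : 3 * Real.exp 1 ^ 2 * (R / t) * (2 * t) = Real.exp 1 ^ 2 * (3 * R) * 2 := by field_simp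
    rw [this]
    have : Real.exp 1 ^ 2 * N ≤ Real.exp 1 ^ 2 * (3 * R) := by gcongr
    have : 0 ≤ Real.exp 1 ^ 2 * (3 * R) := by positivity
    linarith
  set X := A * (R / t) with hX
  have hX0 : 0 < X := by positivity
  have hRt : 0 < R / t := by positivity
  have h1 : m / t + d * sg N t ^ 2 ≤ X := by
    have : (m:ℝ) / t ≤ R / t := by
      gcongr
      have : (m:ℝ) ≤ k := by exact_mod_cast hm
      have : (0:ℝ) ≤ b := by positivity
      linarith
    have : d * sg N t ^ 2 ≤ d * (3 * Real.exp 1 ^ 2 * (R / t)) := by gcongr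
    rw [hX, hA]
    linarith
  have h2 : sg N t ≤ X ^ (1/2 : ℝ) := by
    rw [← Real.sqrt_eq_rpow]
    apply Real.le_sqrt_of_sq_le
    refine hs2.trans ?_
    rw [hX]
    gcongr
    rw [hA]
    have : 1 * (3 * Real.exp 1 ^ 2) ≤ d * (3 * Real.exp 1 ^ 2) := by gcongr
    linarith
  set Q : ℝ := 2 ^ d * d * √A with hQ
  have h2d : (1:ℝ) ≤ 2 ^ d := one_le_pow₀ (by norm_num)
  have hsA : 1 ≤ √A := by rw [Real.one_le_sqrt]; exact hA1
  have hQ1 : 1 ≤ Q := by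
    rw [hQ]
    exact one_le_mul_of_one_le_of_one_le (one_le_mul_of_one_le_of_one_le h2d hd1) hsA
  have hexp : (1/2 : ℝ) ≤ (b:ℝ) / 2 + k := by
    have : (1:ℝ) ≤ b + k := hR1
    have : (0:ℝ) ≤ k := by positivity
    linarith
  have hQ2 : Q ≤ (Q ^ 2) ^ ((b:ℝ) / 2 + k) := by
    calc Q = (Q ^ 2) ^ (1/2 : ℝ) := by
          rw [← Real.sqrt_eq_rpow, Real.sqrt_sq (by linarith)]
      _ ≤ _ := Real.rpow_le_rpow_of_exponent_le (one_le_pow₀ hQ1) hexp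
  have hXp : (X ^ (1/2:ℝ)) ^ (b+1) * X ^ k = X ^ (((b:ℝ) + 1) / 2 + k) := by
    rw [← Real.rpow_natCast, ← Real.rpow_natCast, ← Real.rpow_mul hX0.le, ← Real.rpow_add hX0]
    congr 1
    push_cast
    ring
  have hL : 2 ^ d * t ^ (-θ) * (sg N t ^ b * ((m / t + d * sg N t ^ 2) ^ k *
      (d * (t ^ m * sg N t)))) ≤ 2 ^ d * d * (t ^ (-θ) * t ^ m) * X ^ (((b:ℝ) + 1) / 2 + k) := by
    calc _ = 2 ^ d * d * (t ^ (-θ) * t ^ m) * (sg N t ^ (b+1) * (m / t + d * sg N t ^ 2) ^ k) := by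
          ring
      _ ≤ 2 ^ d * d * (t ^ (-θ) * t ^ m) * ((X ^ (1/2:ℝ)) ^ (b+1) * X ^ k) := by gcongr
      _ = _ := by rw [hXp]
  refine hL.trans ?_
  have hXe : X ^ (((b:ℝ) + 1) / 2 + k) = (√A * A ^ ((b:ℝ) / 2 + k)) * R ^ (((b:ℝ) + 1) / 2 + k) *
      t ^ (-(((b:ℝ) + 1) / 2 + k)) := by
    rw [hX, Real.mul_rpow hA0.le hRt.le, Real.div_rpow hR0.le ht.le, Real.rpow_neg ht.le,
      Real.sqrt_eq_rpow, ← Real.rpow_add hA0, ← div_eq_mul_inv, mul_div_assoc]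
    congr 2
    ring
  have hte : (t ^ (-θ) * t ^ m) * t ^ (-(((b:ℝ) + 1) / 2 + k)) =
      t ^ (-(((b:ℝ) + 2 * ((k:ℝ) - m) + 1) / 2) - θ) := by
    rw [← Real.rpow_natCast, ← Real.rpow_add ht, ← Real.rpow_add ht]
    congr 1
    ring
  have hRe : R ^ (((b:ℝ) + 1) / 2 + k) ≤ R ^ (((b:ℝ) + 1) / 2 + k + θ) :=
    Real.rpow_le_rpow_of_exponent_le hR1 (by linarith)
  calc _ = Q * A ^ ((b:ℝ) / 2 + k) * R ^ (((b:ℝ) + 1) / 2 + k) *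
        ((t ^ (-θ) * t ^ m) * t ^ (-(((b:ℝ) + 1) / 2 + k))) := by rw [hXe, hQ]; ring
    _ ≤ (Q ^ 2) ^ ((b:ℝ) / 2 + k) * A ^ ((b:ℝ) / 2 + k) * R ^ (((b:ℝ) + 1) / 2 + k + θ) *
        ((t ^ (-θ) * t ^ m) * t ^ (-(((b:ℝ) + 1) / 2 + k))) := by gcongr
    _ = _ := by
      rw [hte, Real.mul_rpow hA0.le (by positivity), mul_comm (A ^ _)]

/-- space-time derivative estimates for `t^m ∇G(·,t) ∗ f`, `f ∈ L¹`. -/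
theorem heatKernel_grad_conv_spacetime_deriv_Lq_bound (d : ℕ) (hd : 1 ≤ d) :
    ∃ M₀ : ℝ, 0 < M₀ ∧
      ∀ (f : Euc d → ℝ), MemLp f 1 volume →
        ∀ (β : Fin d → ℕ) (k m : ℕ), 0 < msize β + k → m ≤ k →
          ∀ (q : ℝ≥0∞), 1 ≤ q → ∀ t : ℝ, 0 < t →
            eLpNorm
              (mderiv β (tderiv k (fun s x => s ^ m • convV (gradHeat d s) f x) t)) q volume ≤
              ENNReal.ofReal
                (M₀ ^ ((msize β : ℝ) / 2 + (k : ℝ)) *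
                  ((msize β : ℝ) + (k : ℝ)) ^
                    (((msize β : ℝ) + 1) / 2 + (k : ℝ) + ((d : ℝ) / 2) * (1 - q⁻¹.toReal)) *
                  t ^ (-(((msize β : ℝ) + 2 * ((k : ℝ) - (m : ℝ)) + 1) / 2) -
                        ((d : ℝ) / 2) * (1 - q⁻¹.toReal)) *
                  (eLpNorm f 1 volume).toReal) := by
  refine ⟨(1 + d * (3 * Real.exp 1 ^ 2)) * (2 ^ d * d * √(1 + d * (3 * Real.exp 1 ^ 2))) ^ 2,
    ?_, ?_⟩
  · have : (0:ℝ) < d := by exact_mod_cast hd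
    positivity
  intro f hfm β k m hbk hm q hq t ht
  have hf : Integrable f := memLp_one_iff_integrable.1 hfm
  have hFt : eLpNorm f 1 volume ≠ ⊤ := hfm.eLpNorm_ne_top
  rw [target_eq hf β k m ht]
  have hN : 1 ≤ msize β + 2 * k + 1 := by omega
  have hB := Bd_foldr ht (Bd_dS_iter ht (Bd_S0 (d := d) (N := msize β + 2 * k + 1) (t := t) m) k) β
    (List.finRange d)
  have hms : ((List.finRange d).map β).sum = msize β := by rw [msize, Fin.sum_univ_def]
  rw [hms] at hB
  refine (young hf ht _ _ (ev_bound hN ht (by omega) hB) q hq).trans ?_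
  have hθ : 0 ≤ (d:ℝ) / 2 * (1 - q⁻¹.toReal) := by
    have h1 : q⁻¹.toReal ≤ 1 := by
      rw [← ENNReal.toReal_one]
      exact ENNReal.toReal_mono ENNReal.one_ne_top (ENNReal.inv_le_one.2 hq)
    have : 0 ≤ 1 - q⁻¹.toReal := by linarith
    positivity
  have hfin := final_num hd hbk hm ht hθ
  rw [← mul_assoc, ← ENNReal.ofReal_mul (by positivity)]
  conv_lhs => rw [← ENNReal.ofReal_toReal hFt]
  rw [← ENNReal.ofReal_mul']
  · apply ENNReal.ofReal_le_ofReal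
    exact mul_le_mul_of_nonneg_right hfin ENNReal.toReal_nonneg
  · exact ENNReal.toReal_nonneg

end
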